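/- arXiv:math/0212364 — 2 statements merged into one kernel-verified Lean document; each statement's English description precedes it below -/
import Mathlib

section
/- A harmonic function on $\mathbb{R}^m$ of sub-quadratic growth ($|f(x)| = o(|x|^2)$ as $|x|\to\infty$) is affine: there exist $c \in \mathbb{R}$ and $v \in \mathbb{R}^m$ with $f(x) = c + \langle v, x\rangle$ for all $x$. -/
open scoped RealInnerProductSpace
noncomputable section

/-- The Laplacian on `ℝᵐ` as a sum of second coordinate line derivatives. -/
def lap {m : ℕ} (f : EuclideanSpace ℝ (Fin m) → ℝ)
    (x : EuclideanSpace ℝ (Fin m)) : ℝ :=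
  ∑ i, lineDeriv ℝ (fun y => lineDeriv ℝ f y (EuclideanSpace.single i 1)) x
    (EuclideanSpace.single i 1)

open MeasureTheory Filter Topology
open scoped ContDiff

section Fderiv

variable {E : Type*} [NormedAddCommGroup E] [NormedSpace ℝ E]

lemma ContDiff.fderiv_apply_const {f : E → ℝ} (hf : ContDiff ℝ ∞ f) (v : E) :
    ContDiff ℝ ∞ (fun x => fderiv ℝ f x v) :=
  (hf.fderiv_right (m := ∞) (by simp)).clm_apply contDiff_const

lemma fderiv_fderiv_apply_comm {f : E → ℝ} (hf : ContDiff ℝ ∞ f) (u v x : E) :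
    fderiv ℝ (fun y => fderiv ℝ f y u) x v = fderiv ℝ (fun y => fderiv ℝ f y v) x u := by
  have hd : DifferentiableAt ℝ (fderiv ℝ f) x :=
    (hf.fderiv_right (m := ∞) (by simp)).differentiable (by simp) x
  rw [fderiv_clm_apply hd (differentiableAt_const u), fderiv_clm_apply hd (differentiableAt_const v)]
  simpa using ((contDiff_infty.1 hf 2).contDiffAt.isSymmSndFDerivAt (by simp)).eq v u

lemma hasFDerivAt_comp_add_smul {f : E → ℝ} (hf : ContDiff ℝ 1 f) (x : E) (r : ℝ) (y : E) :
    HasFDerivAt (fun y => f (x + r • y)) (r • fderiv ℝ f (x + r • y)) y := by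
  have h := ((hf.differentiable (by simp)) (x + r • y)).hasFDerivAt.comp y
    (((hasFDerivAt_id y).const_smul r).const_add x)
  exact h.congr_fderiv (by ext v; simp)

/-- If the second derivative of `f` vanishes identically, then `f` is affine. -/
lemma eq_add_fderiv_of_fderiv_fderiv_eq_zero {f : E → ℝ} (hf : ContDiff ℝ ∞ f)
    (h : ∀ u v x, fderiv ℝ (fun y => fderiv ℝ f y u) x v = 0) (x : E) :
    f x = f 0 + fderiv ℝ f 0 x := by
  have hconst : ∀ y, fderiv ℝ f y = fderiv ℝ f 0 := by
    intro y
    ext u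
    refine is_const_of_fderiv_eq_zero (𝕜 := ℝ)
      ((hf.fderiv_apply_const u).differentiable (by simp)) (fun z => ?_) y 0
    ext v
    simpa using h u v z
  have hfd := hf.differentiable (by simp)
  have := is_const_of_fderiv_eq_zero (𝕜 := ℝ) (f := fun y => f y - fderiv ℝ f 0 y)
    (hfd.sub (fderiv ℝ f 0).differentiable)
    (fun z => by
      rw [fderiv_fun_sub (hfd z) (fderiv ℝ f 0).differentiableAt, hconst z]
      simp) x 0
  simp only [map_zero, sub_zero] at this
  linarith

variable [MeasurableSpace E] [BorelSpace E] (μ : Measure E) [μ.IsAddHaarMeasure]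

lemma integral_comp_add_smul_mul_fderiv [FiniteDimensional ℝ E] {f χ : E → ℝ} (hf : ContDiff ℝ 1 f)
    (hχ : ContDiff ℝ 1 χ) (hc : HasCompactSupport χ) (x : E) (r : ℝ) (v : E) :
    ∫ y, f (x + r • y) * fderiv ℝ χ y v ∂μ
      = -(r * ∫ y, fderiv ℝ f (x + r • y) v * χ y ∂μ) := by
  have hfd : ∀ y, fderiv ℝ (fun y => f (x + r • y)) y v = r * fderiv ℝ f (x + r • y) v := by
    intro y
    rw [(hasFDerivAt_comp_add_smul hf x r y).fderiv]
    simp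
  have hf' : Continuous (fderiv ℝ f) := hf.continuous_fderiv (by simp)
  have hχ' : Continuous (fderiv ℝ χ) := hχ.continuous_fderiv (by simp)
  have hf0 := hf.continuous
  have hχ0 := hχ.continuous
  rw [integral_mul_fderiv_eq_neg_fderiv_mul_of_integrable]
  · simp_rw [hfd, mul_assoc]
    rw [integral_const_mul]
  · simp_rw [hfd]
    exact Continuous.integrable_of_hasCompactSupport (by fun_prop) hc.mul_left
  · exact Continuous.integrable_of_hasCompactSupport (by fun_prop) (hc.fderiv_apply ℝ v).mul_left
  · exact Continuous.integrable_of_hasCompactSupport (by fun_prop) hc.mul_left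
  · exact fun y _ => (hasFDerivAt_comp_add_smul hf x r y).differentiableAt
  · exact fun y _ => hχ.differentiable (by simp) y

lemma hasDerivAt_integral_comp_add_smul_mul {f φ : E → ℝ} (hf : ContDiff ℝ 1 f)
    (hφ : Continuous φ) (hc : HasCompactSupport φ) (x : E) (r : ℝ) :
    HasDerivAt (fun r : ℝ => ∫ y, f (x + r • y) * φ y ∂μ)
      (∫ y, fderiv ℝ f (x + r • y) y * φ y ∂μ) r := by
  have hf' : Continuous (fderiv ℝ f) := hf.continuous_fderiv (by simp)
  have hf0 := hf.continuous
  obtain ⟨C, hC⟩ := ((isCompact_closedBall r 1).prod hc).exists_bound_of_continuousOn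
    (f := fun p : ℝ × E => fderiv ℝ f (x + p.1 • p.2) p.2) (by fun_prop)
  refine (hasDerivAt_integral_of_dominated_loc_of_deriv_le
    (F := fun r y => f (x + r • y) * φ y) (F' := fun r y => fderiv ℝ f (x + r • y) y * φ y)
    (bound := fun y => C * |φ y|) (Metric.closedBall_mem_nhds r one_pos) ?_ ?_ ?_ ?_ ?_ ?_).2
  · exact Eventually.of_forall fun s => Continuous.aestronglyMeasurable (by fun_prop)
  · exact Continuous.integrable_of_hasCompactSupport (by fun_prop) hc.mul_left
  · exact Continuous.aestronglyMeasurable (by fun_prop)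
  · refine Eventually.of_forall fun y s hs => ?_
    by_cases hy : y ∈ tsupport φ
    · rw [norm_mul]
      exact mul_le_mul_of_nonneg_right (hC (s, y) ⟨hs, hy⟩) (norm_nonneg _)
    · simp [image_eq_zero_of_notMem_tsupport hy]
  · exact ((hφ.integrable_of_hasCompactSupport hc).abs).const_mul C
  · refine Eventually.of_forall fun y s _ => HasDerivAt.mul_const ?_ _
    have h := ((hf.differentiable (by simp)) (x + s • y)).hasFDerivAt.comp_hasDerivAt s
      (((hasDerivAt_id s).smul_const y).const_add x)
    exact h.congr_deriv (by simp)

end Fderiv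

section Harmonic

variable {E : Type*} [NormedAddCommGroup E] [InnerProductSpace ℝ E]

/-- A nonnegative radial bump function `φ` for which `-2 φ(y) y` is a compactly supported
gradient. -/
lemma exists_radial_bump [FiniteDimensional ℝ E] : ∃ φ ψ : E → ℝ, ContDiff ℝ ∞ φ ∧ ContDiff ℝ 1 ψ ∧
    HasCompactSupport φ ∧ HasCompactSupport ψ ∧ (∀ y, 0 ≤ φ y) ∧ φ 0 ≠ 0 ∧
    (∀ y v, fderiv ℝ ψ y v = -2 * (⟪y, v⟫ * φ y)) := by
  let ρ : ContDiffBump (0 : ℝ) := ⟨1, 2, one_pos, one_lt_two⟩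
  have hρ : ∀ s, 2 ≤ s → ρ s = 0 := fun s hs => ρ.zero_of_le_dist (by
    rw [Real.dist_eq, sub_zero]; exact hs.trans (le_abs_self s))
  let g : ℝ → ℝ := fun s => ∫ t in s..2, ρ t
  have hg : ∀ s, HasDerivAt g (-ρ s) s := fun s =>
    intervalIntegral.integral_hasDerivAt_left (ρ.continuous.intervalIntegrable _ _)
      ρ.continuous.stronglyMeasurable.stronglyMeasurableAtFilter ρ.continuous.continuousAt
  have hg0 : ∀ s, 2 ≤ s → g s = 0 := by
    intro s hs
    refine (intervalIntegral.integral_congr (g := fun _ => (0 : ℝ)) fun t ht => ?_).trans (by simp)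
    rw [Set.uIcc_of_ge hs] at ht
    exact hρ t ht.1
  have hg1 : ContDiff ℝ 1 g := by
    rw [contDiff_one_iff_deriv]
    refine ⟨fun s => (hg s).differentiableAt, ?_⟩
    rw [show deriv g = fun s => -ρ s from funext fun s => (hg s).deriv]
    exact ρ.continuous.neg
  have hsupp : ∀ h : ℝ → ℝ, (∀ s, 2 ≤ s → h s = 0) →
      HasCompactSupport fun y : E => h (‖y‖ ^ 2) := fun h hh =>
    HasCompactSupport.intro (isCompact_closedBall (0 : E) 2) fun y hy => hh _ (by
      simp only [Metric.mem_closedBall, dist_zero_right, not_le] at hy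
      nlinarith)
  refine ⟨fun y => ρ (‖y‖ ^ 2), fun y => g (‖y‖ ^ 2), ρ.contDiff.comp (contDiff_norm_sq ℝ),
    hg1.comp (contDiff_norm_sq ℝ), hsupp _ hρ, hsupp _ hg0, fun y => ρ.nonneg, ?_, fun y v => ?_⟩
  · have : ρ 0 = 1 := ρ.one_of_mem_closedBall (by simp [ρ])
    simp [this]
  · have := (hg (‖y‖ ^ 2)).comp_hasFDerivAt y (hasStrictFDerivAt_norm_sq y).hasFDerivAt
    refine (congrArg (fun L : E →L[ℝ] ℝ => L v) this.fderiv).trans ?_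
    simp
    ring

variable {ι : Type*} [Fintype ι] (b : OrthonormalBasis ι ℝ E)

lemma sum_fderiv_fderiv_fderiv_apply_eq_zero {f : E → ℝ} (hf : ContDiff ℝ ∞ f)
    (h : ∀ x, ∑ i, fderiv ℝ (fun y => fderiv ℝ f y (b i)) x (b i) = 0) (u x : E) :
    ∑ i, fderiv ℝ (fun y => fderiv ℝ (fun z => fderiv ℝ f z u) y (b i)) x (b i) = 0 := by
  have h1 : ∀ i, fderiv ℝ (fun y => fderiv ℝ (fun z => fderiv ℝ f z u) y (b i)) x (b i)
      = fderiv ℝ (fun y => fderiv ℝ (fun z => fderiv ℝ f z (b i)) y (b i)) x u := by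
    intro i
    simp_rw [fderiv_fderiv_apply_comm hf u (b i)]
    exact fderiv_fderiv_apply_comm (hf.fderiv_apply_const (b i)) u (b i) x
  have h2 : fderiv ℝ (fun y => ∑ i, fderiv ℝ (fun z => fderiv ℝ f z (b i)) y (b i)) x u = 0 := by
    simp [h]
  rw [fderiv_fun_sum fun i _ => ((hf.fderiv_apply_const (b i)).fderiv_apply_const
    (b i)).differentiable (by simp) x] at h2
  simpa [h1] using h2

variable [MeasurableSpace E] [BorelSpace E] [FiniteDimensional ℝ E]

/-- Averages of a harmonic function against dilates of a radial bump function. -/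
lemma integral_comp_add_smul_mul_eq (μ : Measure E) [μ.IsAddHaarMeasure] {f φ ψ : E → ℝ}
    (hf : ContDiff ℝ ∞ f)
    (h : ∀ x, ∑ i, fderiv ℝ (fun y => fderiv ℝ f y (b i)) x (b i) = 0)
    (hφ : Continuous φ) (hψ : ContDiff ℝ 1 ψ) (hφc : HasCompactSupport φ)
    (hψc : HasCompactSupport ψ) (hφψ : ∀ y v, fderiv ℝ ψ y v = -2 * (⟪y, v⟫ * φ y))
    (x : E) (r : ℝ) : ∫ y, f (x + r • y) * φ y ∂μ = f x * ∫ y, φ y ∂μ := by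
  have hfi : ∀ i, ContDiff ℝ ∞ fun y => fderiv ℝ f y (b i) := fun i => hf.fderiv_apply_const (b i)
  have hfii : ∀ i, Continuous fun y => fderiv ℝ (fun y => fderiv ℝ f y (b i)) y (b i) :=
    fun i => ((hfi i).fderiv_apply_const (b i)).continuous
  have hψ' : Continuous (fderiv ℝ ψ) := hψ.continuous_fderiv (by simp)
  have hψ0 := hψ.continuous
  have hzero : ∀ s : ℝ, ∫ y, fderiv ℝ f (x + s • y) y * φ y ∂μ = 0 := by
    intro s
    have hexp : ∀ y, fderiv ℝ f (x + s • y) y * φ y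
        = (-1 / 2) * ∑ i, fderiv ℝ f (x + s • y) (b i) * fderiv ℝ ψ y (b i) := by
      intro y
      conv_lhs => rw [← b.sum_repr' y]
      simp only [map_sum, map_smul, hφψ, Finset.sum_mul, Finset.mul_sum, smul_eq_mul]
      rw [b.sum_repr' y]
      refine Finset.sum_congr rfl fun i _ => ?_
      rw [real_inner_comm]
      ring
    have hint : ∀ i, Integrable
        (fun y => fderiv ℝ f (x + s • y) (b i) * fderiv ℝ ψ y (b i)) μ := fun i =>
      Continuous.integrable_of_hasCompactSupport
        (((hfi i).continuous.comp (by fun_prop : Continuous fun y : E => x + s • y)).mul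
          (by fun_prop)) (hψc.fderiv_apply ℝ (b i)).mul_left
    have hint' : ∀ i, Integrable
        (fun y => fderiv ℝ (fun y => fderiv ℝ f y (b i)) (x + s • y) (b i) * ψ y) μ := fun i =>
      Continuous.integrable_of_hasCompactSupport
        (((hfii i).comp (by fun_prop : Continuous fun y : E => x + s • y)).mul hψ0) hψc.mul_left
    simp_rw [hexp]
    rw [integral_const_mul, integral_finsetSum _ fun i _ => hint i]
    have hibp := fun i => integral_comp_add_smul_mul_fderiv μ ((hfi i).of_le (by simp)) hψ hψc x s
      (b i)
    simp_rw [hibp]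
    rw [Finset.sum_neg_distrib, ← Finset.mul_sum, ← integral_finsetSum _ fun i _ => hint' i]
    simp_rw [← Finset.sum_mul, h]
    simp
  have hder := hasDerivAt_integral_comp_add_smul_mul μ (hf.of_le (by simp)) hφ hφc x
  have hconst := is_const_of_deriv_eq_zero (fun s => (hder s).differentiableAt)
    (fun s => by rw [(hder s).deriv, hzero s]) r 0
  simpa [integral_const_mul] using hconst

/-- A harmonic function of sub-quadratic growth has vanishing second derivatives. -/
lemma fderiv_fderiv_eq_zero_of_subquadratic {f : E → ℝ} (hf : ContDiff ℝ ∞ f)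
    (h : ∀ x, ∑ i, fderiv ℝ (fun y => fderiv ℝ f y (b i)) x (b i) = 0)
    (hgrowth : ∀ ε > (0 : ℝ), ∃ R₀ : ℝ, ∀ x, R₀ ≤ ‖x‖ → |f x| ≤ ε * ‖x‖ ^ 2) (u v x : E) :
    fderiv ℝ (fun y => fderiv ℝ f y u) x v = 0 := by
  obtain ⟨φ, ψ, hφ, hψ, hφc, hψc, hφnn, hφ0, hφψ⟩ := exists_radial_bump (E := E)
  let μ : Measure E := Measure.addHaar
  have hφpos : 0 < ∫ y, φ y ∂μ :=
    hφ.continuous.integral_pos_of_hasCompactSupport_nonneg_nonzero hφc hφnn hφ0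
  set φ₂ : E → ℝ := fun y => fderiv ℝ (fun z => fderiv ℝ φ z v) y u with hφ₂
  have hφv := hφ.fderiv_apply_const v
  have hφvc : HasCompactSupport fun z => fderiv ℝ φ z v := hφc.fderiv_apply ℝ v
  have hφ₂c : HasCompactSupport φ₂ := hφvc.fderiv_apply ℝ u
  have hφ₂cont : Continuous φ₂ := (hφv.fderiv_apply_const u).continuous
  have hfu := hf.fderiv_apply_const u
  set H := fderiv ℝ (fun y => fderiv ℝ f y u) x v with hH
  have key : ∀ r : ℝ, r ^ 2 * (H * ∫ y, φ y ∂μ) = ∫ y, f (x + r • y) * φ₂ y ∂μ := by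
    intro r
    rw [hH, ← integral_comp_add_smul_mul_eq b μ (hfu.fderiv_apply_const v)
      (fun x => sum_fderiv_fderiv_fderiv_apply_eq_zero b hfu
        (sum_fderiv_fderiv_fderiv_apply_eq_zero b hf h u) v x)
      hφ.continuous hψ hφc hψc hφψ x r,
      integral_comp_add_smul_mul_fderiv μ (hf.of_le (by simp)) (hφv.of_le (by simp)) hφvc x r u,
      integral_comp_add_smul_mul_fderiv μ (hfu.of_le (by simp)) (hφ.of_le (by simp)) hφc x r v]
    ring
  obtain ⟨K, hK⟩ := hφ₂c.isBounded.exists_norm_le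
  set A := ∫ y, |φ₂ y| ∂μ with hA
  have hA0 : 0 ≤ A := integral_nonneg fun y => abs_nonneg _
  have hbound : ∀ ε > (0 : ℝ), |H| * ∫ y, φ y ∂μ ≤ ε * (((1 + |K|) ^ 2 + 1) * A) := by
    intro ε hε
    obtain ⟨R₀, hR₀⟩ := hgrowth ε hε
    obtain ⟨M, hM⟩ := (isCompact_closedBall (0 : E) R₀).exists_bound_of_continuousOn
      hf.continuous.continuousOn
    have hfle : ∀ z, |f z| ≤ ε * ‖z‖ ^ 2 + |M| := by
      intro z
      rcases le_total R₀ ‖z‖ with hz | hz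
      · exact (hR₀ z hz).trans (le_add_of_nonneg_right (abs_nonneg M))
      · exact ((hM z (by simpa using hz)).trans (le_abs_self M)).trans
          (le_add_of_nonneg_left (by positivity))
    obtain ⟨r, hrx, hr1, hrM⟩ : ∃ r : ℝ, ‖x‖ ≤ r ∧ 1 ≤ r ∧ |M| ≤ ε * r ^ 2 := by
      have hd : 0 ≤ |M| / ε := by positivity
      refine ⟨‖x‖ + 1 + |M| / ε, by linarith, by linarith [norm_nonneg x], ?_⟩
      rw [← div_le_iff₀' hε]
      nlinarith [norm_nonneg x]
    have hr0 : 0 ≤ r := by linarith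
    have hpt : ∀ y, ‖f (x + r • y) * φ₂ y‖ ≤ ε * (((1 + |K|) ^ 2 + 1) * r ^ 2) * |φ₂ y| := by
      intro y
      by_cases hy : y ∈ tsupport φ₂
      · rw [norm_mul]
        refine mul_le_mul_of_nonneg_right ?_ (abs_nonneg _)
        have hn : ‖x + r • y‖ ≤ (1 + |K|) * r := by
          calc ‖x + r • y‖ ≤ ‖x‖ + ‖r • y‖ := norm_add_le _ _
            _ = ‖x‖ + r * ‖y‖ := by rw [norm_smul, Real.norm_of_nonneg hr0]
            _ ≤ r + r * |K| := by gcongr; exact (hK y hy).trans (le_abs_self K)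
            _ = (1 + |K|) * r := by ring
        calc |f (x + r • y)| ≤ ε * ‖x + r • y‖ ^ 2 + |M| := hfle _
          _ ≤ ε * ((1 + |K|) * r) ^ 2 + ε * r ^ 2 := by gcongr
          _ = ε * (((1 + |K|) ^ 2 + 1) * r ^ 2) := by ring
      · simp [image_eq_zero_of_notMem_tsupport hy]
    have hle := norm_integral_le_of_norm_le
      (((hφ₂cont.integrable_of_hasCompactSupport hφ₂c (μ := μ)).abs).const_mul _)
      (Eventually.of_forall hpt)
    rw [← key r, integral_const_mul, norm_mul, norm_mul, Real.norm_of_nonneg (sq_nonneg r),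
      Real.norm_of_nonneg hφpos.le, Real.norm_eq_abs] at hle
    refine le_of_mul_le_mul_left (hle.trans_eq ?_) (by positivity : 0 < r ^ 2)
    ring
  have hle : |H| * ∫ y, φ y ∂μ ≤ 0 := by
    refine le_of_forall_pos_le_add fun δ hδ => ?_
    set B := ((1 + |K|) ^ 2 + 1) * A
    have hB : 0 ≤ B := by positivity
    refine (hbound (δ / (B + 1)) (by positivity)).trans ?_
    rw [zero_add, div_mul_eq_mul_div, div_le_iff₀ (by positivity)]
    nlinarith
  exact abs_nonpos_iff.1 (nonpos_of_mul_nonpos_left hle hφpos)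

end Harmonic

/-- a harmonic function on `ℝᵐ` with sub-quadratic growth
(`|f(x)| = o(|x|²)`) is affine: `f x = c + ⟪v, x⟫`. -/
theorem stmt4 (m : ℕ) (f : EuclideanSpace ℝ (Fin m) → ℝ)
    (hf : ContDiff ℝ (⊤ : ℕ∞) f)
    (hharm : ∀ x, lap f x = 0)
    (hgrowth : ∀ ε > (0 : ℝ), ∃ R₀ : ℝ, ∀ x, R₀ ≤ ‖x‖ → |f x| ≤ ε * ‖x‖ ^ 2) :
    ∃ (c : ℝ) (v : EuclideanSpace ℝ (Fin m)), ∀ x, f x = c + ⟪v, x⟫ := by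
  have hh : ∀ x, ∑ i, fderiv ℝ (fun y => fderiv ℝ f y (EuclideanSpace.basisFun (Fin m) ℝ i)) x
      (EuclideanSpace.basisFun (Fin m) ℝ i) = 0 := by
    intro x
    rw [← hharm x, lap]
    refine Finset.sum_congr rfl fun i _ => ?_
    have hline : ∀ y u, lineDeriv ℝ f y u = fderiv ℝ f y u := fun y u =>
      (hf.differentiable (by simp) y).lineDeriv_eq_fderiv
    simp_rw [hline, EuclideanSpace.basisFun_apply]
    exact (((hf.fderiv_apply_const _).differentiable (by simp)) x).lineDeriv_eq_fderiv.symm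
  refine ⟨f 0, (InnerProductSpace.toDual ℝ _).symm (fderiv ℝ f 0), fun x => ?_⟩
  rw [InnerProductSpace.toDual_symm_apply]
  exact eq_add_fderiv_of_fderiv_fderiv_eq_zero hf
    (fderiv_fderiv_eq_zero_of_subquadratic (EuclideanSpace.basisFun (Fin m) ℝ) hf hh hgrowth) x
end
end

section
/- Suppose $v : \mathbb{R}^m \times [0,T] \to \mathbb{R}$ is smooth, nonnegative, and satisfies $(\Delta - \partial_t) v \ge 0$. Then for the standard heat kernel mean value inequality on Euclidean space: for $R > 0$ with $T = R^2/4$, $\sup_{B(0,R/2)\times[R^2/8, R^2/4]} v \le \frac{C}{R^2 |B(0,R)|}\int_{R^2/16}^{R^2/4}\int_{B(0,R)} v\,dx\,dt$ for a dimensional constant $C = C(m)$. -/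
open MeasureTheory
noncomputable section

lemma lineDeriv_eq_fderiv_of_contDiff {m : ℕ} {f : EuclideanSpace ℝ (Fin m) → ℝ}
    (hf : ContDiff ℝ 2 f) (e : EuclideanSpace ℝ (Fin m)) :
    (fun y => lineDeriv ℝ f y e) = fun y => fderiv ℝ f y e :=
  funext fun _ => (hf.differentiable (by norm_num)).differentiableAt.lineDeriv_eq_fderiv

lemma contDiff_one_fderiv_apply {m : ℕ} {f : EuclideanSpace ℝ (Fin m) → ℝ}
    (hf : ContDiff ℝ 2 f) (e : EuclideanSpace ℝ (Fin m)) :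
    ContDiff ℝ 1 fun y => fderiv ℝ f y e :=
  (hf.fderiv_right (m := 1) (by norm_num)).clm_apply contDiff_const

lemma lap_eq_sum_fderiv {m : ℕ} {f : EuclideanSpace ℝ (Fin m) → ℝ}
    (hf : ContDiff ℝ 2 f) :
    lap f = fun x => ∑ i, fderiv ℝ (fun y => fderiv ℝ f y (EuclideanSpace.single i 1)) x
      (EuclideanSpace.single i 1) := by
  funext x
  refine Finset.sum_congr rfl fun i _ => ?_
  rw [lineDeriv_eq_fderiv_of_contDiff hf]
  exact ((contDiff_one_fderiv_apply hf _).differentiable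
    (by norm_num)).differentiableAt.lineDeriv_eq_fderiv

lemma continuous_lap {m : ℕ} {f : EuclideanSpace ℝ (Fin m) → ℝ}
    (hf : ContDiff ℝ 2 f) : Continuous (lap f) := by
  rw [lap_eq_sum_fderiv hf]
  exact continuous_finsetSum _ fun i _ =>
    ((contDiff_one_fderiv_apply hf _).continuous_fderiv (by norm_num)).clm_apply continuous_const

lemma lap_eq_zero_of_eqOn_const {m : ℕ} {f : EuclideanSpace ℝ (Fin m) → ℝ} {c : ℝ}
    {U : Set (EuclideanSpace ℝ (Fin m))} (hU : IsOpen U) (hf : ∀ y ∈ U, f y = c)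
    {x : EuclideanSpace ℝ (Fin m)} (hx : x ∈ U) : lap f x = 0 := by
  have key : ∀ {g : EuclideanSpace ℝ (Fin m) → ℝ} {c : ℝ}, (∀ y ∈ U, g y = c) →
      ∀ e, ∀ y ∈ U, lineDeriv ℝ g y e = 0 := by
    intro g c hg e y hy
    have h : g =ᶠ[nhds y] fun _ => c := by
      filter_upwards [hU.mem_nhds hy] with z hz using hg z hz
    rw [h.lineDeriv_eq]
    simp [lineDeriv]
  exact Finset.sum_eq_zero fun i _ => key (key hf _) _ x hx

lemma lap_const_mul {m : ℕ} (a : ℝ) (f : EuclideanSpace ℝ (Fin m) → ℝ)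
    (x : EuclideanSpace ℝ (Fin m)) : lap (fun y => a * f y) x = a * lap f x := by
  simp only [lap, lineDeriv, deriv_const_mul_field, Finset.mul_sum]

lemma lineDeriv_comp_add_smul {m : ℕ} (f : EuclideanSpace ℝ (Fin m) → ℝ) (r : ℝ)
    (x y e : EuclideanSpace ℝ (Fin m)) :
    lineDeriv ℝ (fun z => f (x + r • z)) y e = r * lineDeriv ℝ f (x + r • y) e := by
  have := deriv_comp_mul_left r (fun t : ℝ => f (x + r • y + t • e)) 0
  rw [mul_zero, smul_eq_mul] at this
  simp only [lineDeriv]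
  rw [← this]
  congr 1
  funext t
  rw [smul_add, smul_smul, add_assoc]

lemma lap_comp_add_smul {m : ℕ} (f : EuclideanSpace ℝ (Fin m) → ℝ) (r : ℝ)
    (x y : EuclideanSpace ℝ (Fin m)) :
    lap (fun z => f (x + r • z)) y = r ^ 2 * lap f (x + r • y) := by
  rw [lap, lap, Finset.mul_sum]
  refine Finset.sum_congr rfl fun i _ => ?_
  simp_rw [lineDeriv_comp_add_smul f]
  have h := lineDeriv_comp_add_smul
    (fun z => r * lineDeriv ℝ f z (EuclideanSpace.single i 1)) r x y (EuclideanSpace.single i 1)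
  rw [h]
  simp only [lineDeriv, deriv_const_mul_field]
  ring

/-- Green's identity for a compactly supported factor. -/
lemma integral_lap_mul {m : ℕ} {f g : EuclideanSpace ℝ (Fin m) → ℝ}
    (hf : ContDiff ℝ 2 f) (hg : ContDiff ℝ 2 g) (hgc : HasCompactSupport g) :
    ∫ x, lap f x * g x = ∫ x, f x * lap g x := by
  have hf0 := hf.continuous
  have hg0 := hg.continuous
  have hfi := fun e => contDiff_one_fderiv_apply hf e
  have hgi := fun e => contDiff_one_fderiv_apply hg e
  have hfii : ∀ e, Continuous fun x => fderiv ℝ (fun y => fderiv ℝ f y e) x e := fun e =>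
    ((hfi e).continuous_fderiv (by norm_num)).clm_apply continuous_const
  have hgii : ∀ e, Continuous fun x => fderiv ℝ (fun y => fderiv ℝ g y e) x e := fun e =>
    ((hgi e).continuous_fderiv (by norm_num)).clm_apply continuous_const
  have hgic : ∀ e, HasCompactSupport fun y => fderiv ℝ g y e := fun e => hgc.fderiv_apply ℝ e
  have hgiic : ∀ e, HasCompactSupport fun x => fderiv ℝ (fun y => fderiv ℝ g y e) x e :=
    fun e => (hgic e).fderiv_apply ℝ e
  have i1 : ∀ e, Integrable fun x => fderiv ℝ (fun y => fderiv ℝ f y e) x e * g x := fun e =>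
    ((hfii e).mul hg0).integrable_of_hasCompactSupport hgc.mul_left
  have i2 : ∀ e, Integrable fun x => fderiv ℝ f x e * fderiv ℝ g x e := fun e =>
    ((hfi e).continuous.mul (hgi e).continuous).integrable_of_hasCompactSupport (hgic e).mul_left
  have i3 : ∀ e, Integrable fun x => fderiv ℝ f x e * g x := fun e =>
    ((hfi e).continuous.mul hg0).integrable_of_hasCompactSupport hgc.mul_left
  have i4 : ∀ e, Integrable fun x => f x * fderiv ℝ g x e := fun e =>
    (hf0.mul (hgi e).continuous).integrable_of_hasCompactSupport (hgic e).mul_left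
  have i5 : ∀ e, Integrable fun x => f x * fderiv ℝ (fun y => fderiv ℝ g y e) x e := fun e =>
    (hf0.mul (hgii e)).integrable_of_hasCompactSupport (hgiic e).mul_left
  rw [lap_eq_sum_fderiv hf, lap_eq_sum_fderiv hg]
  simp_rw [Finset.sum_mul, Finset.mul_sum]
  rw [integral_finsetSum _ fun i _ => i1 _, integral_finsetSum _ fun i _ => i5 _]
  refine Finset.sum_congr rfl fun i _ => ?_
  have a := integral_mul_fderiv_eq_neg_fderiv_mul_of_integrable (i1 (EuclideanSpace.single i 1))
    (i2 _) (i3 _) (fun x _ => ((hfi _).differentiable (by norm_num)).differentiableAt)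
    (fun x _ => (hg.differentiable (by norm_num)).differentiableAt)
  have b := integral_mul_fderiv_eq_neg_fderiv_mul_of_integrable (i2 (EuclideanSpace.single i 1))
    (i5 _) (i4 _) (fun x _ => (hf.differentiable (by norm_num)).differentiableAt)
    (fun x _ => ((hgi _).differentiable (by norm_num)).differentiableAt)
  rw [b, a, neg_neg]

/-- The slices of a smooth function on space-time. -/
lemma contDiff_slice {m : ℕ} {u : EuclideanSpace ℝ (Fin m) → ℝ → ℝ}
    (hu : ContDiff ℝ (⊤ : ℕ∞) fun p : EuclideanSpace ℝ (Fin m) × ℝ => u p.1 p.2) (s : ℝ) :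
    ContDiff ℝ 2 fun y => u y s :=
  ContDiff.comp (mod_cast contDiff_infty.1 hu 2) (contDiff_id.prodMk contDiff_const)

lemma hasDerivAt_time {m : ℕ} {u : EuclideanSpace ℝ (Fin m) → ℝ → ℝ}
    (hu : ContDiff ℝ (⊤ : ℕ∞) fun p : EuclideanSpace ℝ (Fin m) × ℝ => u p.1 p.2)
    (y : EuclideanSpace ℝ (Fin m)) (s : ℝ) : HasDerivAt (u y) (deriv (u y) s) s := by
  have : ContDiff ℝ (⊤ : ℕ∞) (u y) := hu.comp (contDiff_const.prodMk contDiff_id)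
  exact (this.differentiable (by norm_num)).differentiableAt.hasDerivAt

lemma continuous_deriv_time {m : ℕ} {u : EuclideanSpace ℝ (Fin m) → ℝ → ℝ}
    (hu : ContDiff ℝ (⊤ : ℕ∞) fun p : EuclideanSpace ℝ (Fin m) × ℝ => u p.1 p.2) :
    Continuous fun p : EuclideanSpace ℝ (Fin m) × ℝ => deriv (u p.1) p.2 := by
  have h : (fun p : EuclideanSpace ℝ (Fin m) × ℝ => deriv (u p.1) p.2) = fun p =>
      fderiv ℝ (fun p : EuclideanSpace ℝ (Fin m) × ℝ => u p.1 p.2) p (0, 1) := by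
    funext p
    have h1 := (hu.differentiable (by norm_num)).differentiableAt (x := p) |>.hasFDerivAt
    have h2 : HasDerivAt (fun s : ℝ => (p.1, s)) ((0 : EuclideanSpace ℝ (Fin m)), (1 : ℝ)) p.2 :=
      (hasDerivAt_const _ _).prodMk (hasDerivAt_id _)
    exact (h1.comp_hasDerivAt p.2 h2).deriv
  rw [h]
  exact (hu.continuous_fderiv (by norm_num)).clm_apply continuous_const

/-- A space-time function continuous on a compact product is integrable for the product of the
restricted measures. -/
lemma integrable_prod_of_continuousOn {m : ℕ} {F : EuclideanSpace ℝ (Fin m) × ℝ → ℝ}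
    {K : Set (EuclideanSpace ℝ (Fin m))} {I : Set ℝ} (hK : IsCompact K) (hI : IsCompact I)
    (hF : ContinuousOn F (K ×ˢ I)) :
    Integrable F ((volume.restrict K).prod (volume.restrict I)) := by
  rw [Measure.prod_restrict]
  exact hF.integrableOn_compact (hK.prod hI)

/-- Duality: testing a nonnegative subsolution against a compactly supported weight that is almost
a solution of the backward heat equation. -/
lemma integral_mul_le_of_subsolution {m : ℕ} {u : EuclideanSpace ℝ (Fin m) → ℝ → ℝ}
    (hu : ContDiff ℝ (⊤ : ℕ∞) fun p : EuclideanSpace ℝ (Fin m) × ℝ => u p.1 p.2)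
    (hu0 : ∀ y, ∀ s ∈ Set.Icc (-1 : ℝ) 0, 0 ≤ u y s)
    (hsub : ∀ y, ∀ s ∈ Set.Icc (-1 : ℝ) 0, 0 ≤ lap (fun z => u z s) y - deriv (u y) s)
    {w w' : EuclideanSpace ℝ (Fin m) → ℝ → ℝ} {C : ℝ}
    (hw : ∀ s ∈ Set.Icc (-1 : ℝ) 0, ContDiff ℝ 2 fun y => w y s)
    (hwK : ∀ s ∈ Set.Icc (-1 : ℝ) 0, ∀ y ∉ Metric.closedBall 0 2, w y s = 0)
    (hw0 : ∀ y, ∀ s ∈ Set.Icc (-1 : ℝ) 0, 0 ≤ w y s)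
    (hw' : ∀ y, ∀ s ∈ Set.Icc (-1 : ℝ) 0, HasDerivAt (w y) (w' y s) s)
    (hwc : ContinuousOn (fun p : EuclideanSpace ℝ (Fin m) × ℝ => w p.1 p.2)
      (Set.univ ×ˢ Set.Icc (-1 : ℝ) 0))
    (hw'c : ContinuousOn (fun p : EuclideanSpace ℝ (Fin m) × ℝ => w' p.1 p.2)
      (Set.univ ×ˢ Set.Icc (-1 : ℝ) 0))
    (hinit : ∀ y, w y (-1) = 0)
    (hb : ∀ y, ∀ s ∈ Set.Icc (-1 : ℝ) 0, lap (fun z => w z s) y + w' y s ≤ C) :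
    ∫ y in Metric.closedBall 0 2, u y 0 * w y 0 ≤
      C * ∫ s in Set.Icc (-1 : ℝ) 0, ∫ y in Metric.closedBall 0 2, u y s := by
  set K : Set (EuclideanSpace ℝ (Fin m)) := Metric.closedBall 0 2
  have hK : IsCompact K := isCompact_closedBall _ _
  have hI : IsCompact (Set.Icc (-1 : ℝ) 0) := isCompact_Icc
  have hut := continuous_deriv_time hu
  have hcont : ContinuousOn (fun p : EuclideanSpace ℝ (Fin m) × ℝ =>
      deriv (u p.1) p.2 * w p.1 p.2 + u p.1 p.2 * w' p.1 p.2)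
      (Set.univ ×ˢ Set.Icc (-1 : ℝ) 0) :=
    (hut.continuousOn.mul hwc).add (hu.continuous.continuousOn.mul hw'c)
  have hint := integrable_prod_of_continuousOn hK hI
    (hcont.mono (Set.prod_mono (Set.subset_univ K) le_rfl))
  have hintu := integrable_prod_of_continuousOn hK hI (F := fun p => u p.1 p.2)
    hu.continuous.continuousOn
  have ftc : ∀ y, u y 0 * w y 0 = ∫ s in Set.Icc (-1 : ℝ) 0,
      (deriv (u y) s * w y s + u y s * w' y s) := by
    intro y
    have hmap : ContinuousOn (fun s => deriv (u y) s * w y s + u y s * w' y s)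
        (Set.Icc (-1 : ℝ) 0) :=
      hcont.comp (f := fun s : ℝ => (y, s)) (by fun_prop) fun s hs => ⟨trivial, hs⟩
    have := intervalIntegral.integral_eq_sub_of_hasDerivAt (a := -1) (b := 0)
      (f := fun s => u y s * w y s) (f' := fun s => deriv (u y) s * w y s + u y s * w' y s)
      (fun s hs => by
        rw [Set.uIcc_of_le (by norm_num)] at hs
        exact (hasDerivAt_time hu y s).mul (hw' y s hs))
      (ContinuousOn.intervalIntegrable (by rwa [Set.uIcc_of_le (by norm_num)]))
    rw [integral_Icc_eq_integral_Ioc, ← intervalIntegral.integral_of_le (by norm_num), this]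
    simp [hinit]
  simp_rw [ftc]
  rw [integral_integral_swap hint, ← integral_const_mul]
  refine setIntegral_mono_on hint.integral_prod_right (hintu.integral_prod_right.const_mul C)
    measurableSet_Icc fun s hs => ?_
  have hus := contDiff_slice hu s
  have hws := hw s hs
  have hwcs : HasCompactSupport fun y => w y s := HasCompactSupport.intro hK (hwK s hs)
  have hw's : Continuous fun y => w' y s := by
    rw [← continuousOn_univ]
    exact hw'c.comp (f := fun y : EuclideanSpace ℝ (Fin m) => (y, s)) (by fun_prop)
      fun y _ => ⟨trivial, hs⟩
  have huts : Continuous fun y => deriv (u y) s :=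
    hut.comp (f := fun y : EuclideanSpace ℝ (Fin m) => (y, s)) (by fun_prop)
  have hio : ∀ {g : EuclideanSpace ℝ (Fin m) → ℝ}, Continuous g → IntegrableOn g K := fun hg =>
    hg.continuousOn.integrableOn_compact hK
  have h1 : IntegrableOn (fun y => deriv (u y) s * w y s) K := hio (huts.mul hws.continuous)
  have h2 : IntegrableOn (fun y => u y s * w' y s) K := hio (hus.continuous.mul hw's)
  have h3 : IntegrableOn (fun y => lap (fun z => u z s) y * w y s) K :=
    hio ((continuous_lap hus).mul hws.continuous)
  have h4 : IntegrableOn (fun y => u y s * lap (fun z => w z s) y) K :=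
    hio (hus.continuous.mul (continuous_lap hws))
  have h5 : IntegrableOn (fun y => u y s) K := hio hus.continuous
  have green : ∫ y in K, lap (fun z => u z s) y * w y s =
      ∫ y in K, u y s * lap (fun z => w z s) y := by
    rw [setIntegral_eq_integral_of_forall_compl_eq_zero,
      setIntegral_eq_integral_of_forall_compl_eq_zero]
    · exact integral_lap_mul hus hws hwcs
    · intro y hy
      rw [lap_eq_zero_of_eqOn_const Metric.isClosed_closedBall.isOpen_compl
        (fun z hz => hwK s hs z hz) hy, mul_zero]
    · intro y hy
      rw [hwK s hs y hy, mul_zero]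
  calc ∫ y in K, (deriv (u y) s * w y s + u y s * w' y s)
      ≤ ∫ y in K, (lap (fun z => u z s) y * w y s + u y s * w' y s) := by
        refine setIntegral_mono (h1.add h2) (h3.add h2) fun y => ?_
        have := mul_le_mul_of_nonneg_right (sub_nonneg.1 (hsub y s hs)) (hw0 y s hs)
        simpa using this
    _ = ∫ y in K, (u y s * lap (fun z => w z s) y + u y s * w' y s) := by
        rw [integral_add h3 h2, integral_add h4 h2, green]
    _ ≤ ∫ y in K, C * u y s := by
        refine setIntegral_mono (h4.add h2) (h5.const_mul C) fun y => ?_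
        have := mul_le_mul_of_nonneg_left (hb y s hs) (hu0 y s hs)
        dsimp only
        linarith
    _ = C * ∫ y in K, u y s := integral_const_mul _ _

/-- The heat kernel at time `τ`, without its dimensional constant. -/
def gaussKernel {m : ℕ} (τ : ℝ) (y : EuclideanSpace ℝ (Fin m)) : ℝ :=
  τ ^ (-(m / 2 : ℝ)) * Real.exp (-‖y‖ ^ 2 / (4 * τ))

lemma gaussKernel_nonneg {m : ℕ} {τ : ℝ} (hτ : 0 ≤ τ) (y : EuclideanSpace ℝ (Fin m)) :
    0 ≤ gaussKernel τ y :=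
  mul_nonneg (Real.rpow_nonneg hτ _) (Real.exp_nonneg _)

lemma contDiff_gaussKernel {m : ℕ} (τ : ℝ) :
    ContDiff ℝ 2 (gaussKernel τ : EuclideanSpace ℝ (Fin m) → ℝ) := by
  unfold gaussKernel
  exact contDiff_const.mul (((contDiff_norm_sq ℝ).neg.div_const _).exp)

lemma continuousOn_gaussKernel {m : ℕ} :
    ContinuousOn (fun p : ℝ × EuclideanSpace ℝ (Fin m) => gaussKernel p.1 p.2)
      (Set.Ioi 0 ×ˢ Set.univ) := by
  unfold gaussKernel
  refine ContinuousOn.mul ?_ (ContinuousOn.rexp ?_)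
  · exact continuousOn_fst.rpow_const fun p hp => Or.inl (ne_of_gt hp.1)
  · refine ContinuousOn.div (by fun_prop) (by fun_prop) fun p hp => ?_
    have : (0 : ℝ) < p.1 := hp.1
    positivity

lemma hasDerivAt_gaussKernel_time {m : ℕ} {τ : ℝ} (hτ : 0 < τ) (y : EuclideanSpace ℝ (Fin m)) :
    HasDerivAt (fun τ => gaussKernel τ y)
      ((‖y‖ ^ 2 / (4 * τ ^ 2) - m / (2 * τ)) * gaussKernel τ y) τ := by
  have h1 := Real.hasDerivAt_rpow_const (p := -(m / 2 : ℝ)) (Or.inl hτ.ne')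
  have h2 : HasDerivAt (fun τ : ℝ => -‖y‖ ^ 2 / (4 * τ)) (‖y‖ ^ 2 / (4 * τ ^ 2)) τ := by
    have := (hasDerivAt_const τ (-‖y‖ ^ 2)).div ((hasDerivAt_id τ).const_mul 4)
      (by simpa using hτ.ne')
    refine this.congr_deriv ?_
    simp only [id]
    field_simp
    ring
  refine (h1.mul h2.exp).congr_deriv ?_
  rw [Real.rpow_sub_one hτ.ne', gaussKernel]
  field_simp
  ring

lemma hasLineDerivAt_gaussKernel {m : ℕ} (τ : ℝ) (y : EuclideanSpace ℝ (Fin m)) (i : Fin m) :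
    HasLineDerivAt ℝ (gaussKernel τ) (-(y i) / (2 * τ) * gaussKernel τ y) y
      (EuclideanSpace.single i 1) := by
  have h0 : HasDerivAt (fun t : ℝ => ‖y + t • EuclideanSpace.single i (1 : ℝ)‖ ^ 2) (2 * y i) 0 := by
    have h : HasDerivAt (fun t : ℝ => y + t • EuclideanSpace.single i (1 : ℝ))
        (EuclideanSpace.single i (1 : ℝ)) 0 := by
      simpa using ((hasDerivAt_id (0 : ℝ)).smul_const (EuclideanSpace.single i (1 : ℝ))).const_add y
    refine h.norm_sq.congr_deriv ?_
    simp [EuclideanSpace.inner_single_right]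
  have := ((h0.neg.div_const (4 * τ)).exp).const_mul (τ ^ (-(m / 2 : ℝ)))
  refine HasDerivAt.congr_deriv this ?_
  simp only [gaussKernel, Pi.neg_apply, zero_smul, add_zero]
  ring

lemma lap_mul_gaussKernel {m : ℕ} {χ : EuclideanSpace ℝ (Fin m) → ℝ} (hχ : ContDiff ℝ 2 χ)
    {τ : ℝ} (hτ : 0 < τ) (y : EuclideanSpace ℝ (Fin m)) :
    lap (fun z => χ z * gaussKernel τ z) y =
      gaussKernel τ y * lap χ y
        - (∑ i, fderiv ℝ χ y (EuclideanSpace.single i 1) * y i) * (gaussKernel τ y / τ)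
        + χ y * ((‖y‖ ^ 2 / (4 * τ ^ 2) - m / (2 * τ)) * gaussKernel τ y) := by
  have hd : ∀ {f : EuclideanSpace ℝ (Fin m) → ℝ}, ContDiff ℝ 1 f → ∀ z e,
      HasLineDerivAt ℝ f (fderiv ℝ f z e) z e := fun hf z e =>
    ((hf.differentiable (by norm_num)).differentiableAt.hasFDerivAt).hasLineDerivAt e
  have hmul : ∀ {f g : EuclideanSpace ℝ (Fin m) → ℝ} {f' g' : ℝ} {z e},
      HasLineDerivAt ℝ f f' z e → HasLineDerivAt ℝ g g' z e →
      HasLineDerivAt ℝ (fun z => f z * g z) (f' * g z + f z * g') z e := by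
    intro f g f' g' z e hf hg
    refine HasDerivAt.congr_deriv (HasDerivAt.mul hf hg) ?_
    simp
  have hcoord : ∀ (i : Fin m) z, HasLineDerivAt ℝ
      (fun z : EuclideanSpace ℝ (Fin m) => -(z i) / (2 * τ)) (-1 / (2 * τ)) z
      (EuclideanSpace.single i 1) := by
    intro i z
    have h : HasDerivAt (fun t : ℝ => z i + t * 1) 1 0 := by
      simpa using (hasDerivAt_id (0 : ℝ)).const_add (z i)
    simpa [HasLineDerivAt] using h.neg.div_const (2 * τ)
  have hfirst : ∀ i : Fin m, (fun z => lineDeriv ℝ (fun z => χ z * gaussKernel τ z) z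
      (EuclideanSpace.single i 1)) = fun z =>
      fderiv ℝ χ z (EuclideanSpace.single i 1) * gaussKernel τ z +
        χ z * (-(z i) / (2 * τ) * gaussKernel τ z) := fun i => funext fun z =>
    (hmul (hd (hχ.of_le (by norm_num)) z _) (hasLineDerivAt_gaussKernel τ z i)).lineDeriv
  have hsecond : ∀ i : Fin m, lineDeriv ℝ (fun z => lineDeriv ℝ (fun z => χ z * gaussKernel τ z) z
      (EuclideanSpace.single i 1)) y (EuclideanSpace.single i 1) =
      gaussKernel τ y * fderiv ℝ (fun z => fderiv ℝ χ z (EuclideanSpace.single i 1)) y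
        (EuclideanSpace.single i 1)
      - fderiv ℝ χ y (EuclideanSpace.single i 1) * y i * (gaussKernel τ y / τ)
      + χ y * (((y i) ^ 2 / (4 * τ ^ 2) - 1 / (2 * τ)) * gaussKernel τ y) := by
    intro i
    rw [hfirst i]
    have hK := hasLineDerivAt_gaussKernel τ y i
    have := HasDerivAt.add (hmul
      (hd (contDiff_one_fderiv_apply hχ (EuclideanSpace.single i 1)) y _) hK)
      (hmul (hd (hχ.of_le (by norm_num)) y _) (hmul (hcoord i y) hK))
    refine (HasDerivAt.deriv this).trans ?_
    field_simp
    ring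
  rw [lap, Finset.sum_congr rfl fun i _ => hsecond i, Finset.sum_add_distrib,
    Finset.sum_sub_distrib, ← Finset.mul_sum, ← Finset.sum_mul, ← Finset.mul_sum,
    ← Finset.sum_mul, Finset.sum_sub_distrib, ← Finset.sum_div, lap_eq_sum_fderiv hχ,
    EuclideanSpace.real_norm_sq_eq]
  simp only [Finset.sum_const, Finset.card_univ, Fintype.card_fin, nsmul_eq_mul]
  ring

lemma exists_rpow_mul_exp_le (a : ℝ) (ha : 0 < a) :
    ∃ B > 0, ∀ τ : ℝ, 0 < τ → τ ^ (-a) * Real.exp (-1 / (4 * τ)) ≤ B := by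
  refine ⟨Real.exp (a * Real.log (4 * a)), Real.exp_pos _, fun τ hτ => ?_⟩
  rw [Real.rpow_def_of_pos hτ, ← Real.exp_add, Real.exp_le_exp]
  have h := Real.log_le_sub_one_of_pos (show 0 < 1 / (4 * a * τ) by positivity)
  rw [one_div, Real.log_inv, Real.log_mul (by positivity) hτ.ne'] at h
  have h2 := mul_le_mul_of_nonneg_left h ha.le
  have h3 : a * ((4 * a * τ)⁻¹ - 1) = 1 / (4 * τ) - a := by field_simp
  rw [h3] at h2
  have : -1 / (4 * τ) = -(1 / (4 * τ)) := by ring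
  rw [this]
  linarith

/-- Away from the origin the kernel is bounded, uniformly as `τ → 0`. -/
lemma exists_gaussKernel_bound (m : ℕ) : ∃ B > 0, ∀ τ : ℝ, 0 < τ → τ ≤ 2 →
    ∀ y : EuclideanSpace ℝ (Fin m), 1 ≤ ‖y‖ →
      gaussKernel τ y ≤ B ∧ gaussKernel τ y / τ ≤ B := by
  obtain ⟨B, hB, h⟩ := exists_rpow_mul_exp_le (m / 2 + 1 : ℝ) (by positivity)
  refine ⟨2 * B, by positivity, fun τ hτ hτ2 y hy => ?_⟩
  have key : gaussKernel τ y / τ ≤ B := by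
    refine le_trans ?_ (h τ hτ)
    have e : τ ^ (-(m / 2 + 1 : ℝ)) = τ ^ (-(m / 2 : ℝ)) / τ := by
      rw [← Real.rpow_sub_one hτ.ne']; ring_nf
    rw [gaussKernel, e, div_mul_eq_mul_div]
    have : (1 : ℝ) ≤ ‖y‖ ^ 2 := one_le_pow₀ hy
    gcongr
  refine ⟨?_, by linarith⟩
  rw [div_le_iff₀ hτ] at key
  nlinarith

lemma gaussKernel_le_of_half_le {m : ℕ} {τ : ℝ} (hτ : 1 / 2 ≤ τ) (y : EuclideanSpace ℝ (Fin m)) :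
    gaussKernel τ y ≤ (1 / 2) ^ (-(m / 2 : ℝ)) := by
  have h1 : τ ^ (-(m / 2 : ℝ)) ≤ (1 / 2) ^ (-(m / 2 : ℝ)) :=
    Real.rpow_le_rpow_of_nonpos (by norm_num) hτ (by simp; positivity)
  have h2 : Real.exp (-‖y‖ ^ 2 / (4 * τ)) ≤ 1 := by
    rw [Real.exp_le_one_iff]
    exact div_nonpos_of_nonpos_of_nonneg (by simp) (by linarith)
  calc gaussKernel τ y ≤ τ ^ (-(m / 2 : ℝ)) * 1 :=
        mul_le_mul_of_nonneg_left h2 (Real.rpow_nonneg (by linarith) _)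
    _ ≤ _ := by simpa using h1

/-- The kernels with `τ = 1 / (4 c²)` form an approximate identity as `c → ∞`. -/
lemma tendsto_integral_gaussKernel {m : ℕ} {g : EuclideanSpace ℝ (Fin m) → ℝ}
    (hg : Continuous g) (hgi : Integrable g) :
    Filter.Tendsto (fun c : ℝ => ∫ y, g y * gaussKernel (1 / (4 * c ^ 2)) y) Filter.atTop
      (nhds ((4 * Real.pi) ^ (m / 2 : ℝ) * g 0)) := by
  set A : ℝ := Real.pi ^ (m / 2 : ℝ) with hA
  have hA0 : 0 < A := Real.rpow_pos_of_pos Real.pi_pos _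
  have hone : ∫ y : EuclideanSpace ℝ (Fin m), A⁻¹ * Real.exp (-‖y‖ ^ 2) = 1 := by
    have := GaussianFourier.integral_rexp_neg_mul_sq_norm (V := EuclideanSpace ℝ (Fin m))
      one_pos
    simp only [neg_mul, one_mul, div_one, finrank_euclideanSpace, Fintype.card_fin] at this
    rw [integral_const_mul, this, ← hA, inv_mul_cancel₀ hA0.ne']
  have hdecay : Filter.Tendsto (fun y : EuclideanSpace ℝ (Fin m) =>
      ‖y‖ ^ Module.finrank ℝ (EuclideanSpace ℝ (Fin m)) * (A⁻¹ * Real.exp (-‖y‖ ^ 2)))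
      (Bornology.cobounded _) (nhds 0) := by
    have h := ((Real.tendsto_pow_mul_exp_neg_atTop_nhds_zero m).const_mul A⁻¹).comp
      (tendsto_norm_cobounded_atTop (E := EuclideanSpace ℝ (Fin m)))
    rw [mul_zero] at h
    refine squeeze_zero' (Filter.Eventually.of_forall fun y => by positivity) ?_ h
    filter_upwards [tendsto_norm_cobounded_atTop.eventually_ge_atTop 1] with y hy
    rw [finrank_euclideanSpace, Fintype.card_fin, Function.comp, mul_left_comm]
    have : ‖y‖ ≤ ‖y‖ ^ 2 := by nlinarith
    gcongr
  have h := (tendsto_integral_comp_smul_smul_of_integrable (fun y => by positivity) hone hdecay hgi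
    hg.continuousAt).const_mul ((4 * Real.pi) ^ (m / 2 : ℝ))
  refine h.congr' ?_
  filter_upwards [Filter.eventually_gt_atTop 0] with c hc
  rw [← integral_const_mul]
  refine integral_congr_ae (Filter.Eventually.of_forall fun y => ?_)
  have e1 : (1 / (4 * c ^ 2)) ^ (-(m / 2 : ℝ)) = 4 ^ (m / 2 : ℝ) * c ^ m := by
    rw [one_div, Real.inv_rpow (by positivity), Real.rpow_neg (by positivity), inv_inv,
      Real.mul_rpow (by norm_num) (by positivity), ← Real.rpow_natCast c 2, ← Real.rpow_mul hc.le,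
      ← Real.rpow_natCast c m]
    congr 2
    push_cast
    ring
  have e2 : -‖y‖ ^ 2 / (4 * (1 / (4 * c ^ 2))) = -‖c • y‖ ^ 2 := by
    rw [norm_smul, mul_pow, Real.norm_eq_abs, sq_abs]
    field_simp
  simp only [gaussKernel, smul_eq_mul, finrank_euclideanSpace, Fintype.card_fin]
  rw [e1, e2, Real.mul_rpow (by norm_num) Real.pi_pos.le, ← hA]
  field_simp

/-- The mean value inequality at the origin of the unit parabolic cylinder. -/
lemma exists_mean_value_unit (m : ℕ) : ∃ C > (0 : ℝ),
    ∀ u : EuclideanSpace ℝ (Fin m) → ℝ → ℝ,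
      ContDiff ℝ (⊤ : ℕ∞) (fun p : EuclideanSpace ℝ (Fin m) × ℝ => u p.1 p.2) →
      (∀ y, ∀ s ∈ Set.Icc (-1 : ℝ) 0, 0 ≤ u y s) →
      (∀ y, ∀ s ∈ Set.Icc (-1 : ℝ) 0, 0 ≤ lap (fun z => u z s) y - deriv (u y) s) →
      u 0 0 ≤ C * ∫ s in Set.Icc (-1 : ℝ) 0, ∫ y in Metric.closedBall 0 2, u y s := by
  let χ : ContDiffBump (0 : EuclideanSpace ℝ (Fin m)) := ⟨1, 2, one_pos, one_lt_two⟩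
  have hχ : ContDiff ℝ 2 χ := χ.contDiff (n := 2)
  have hχ1 : ∀ y ∈ Metric.ball (0 : EuclideanSpace ℝ (Fin m)) 1, χ y = 1 := fun y hy =>
    χ.one_of_mem_closedBall (Metric.ball_subset_closedBall hy)
  have hχ0 : ∀ y ∉ Metric.closedBall (0 : EuclideanSpace ℝ (Fin m)) 2, χ y = 0 := fun y hy =>
    χ.zero_of_le_dist (not_le.1 hy).le
  let P : EuclideanSpace ℝ (Fin m) → ℝ := fun y =>
    ∑ i, fderiv ℝ χ y (EuclideanSpace.single i 1) * y i
  have hPc : Continuous P := continuous_finsetSum _ fun i _ =>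
    (contDiff_one_fderiv_apply hχ _).continuous.mul (by fun_prop)
  have hfd : ∀ {U : Set (EuclideanSpace ℝ (Fin m))} {c : ℝ}, IsOpen U → (∀ y ∈ U, χ y = c) →
      ∀ y ∈ U, P y = 0 := by
    intro U c hU h y hy
    have he : (χ : EuclideanSpace ℝ (Fin m) → ℝ) =ᶠ[nhds y] fun _ => c := by
      filter_upwards [hU.mem_nhds hy] with z hz using h z hz
    simp [P, he.fderiv_eq]
  have hKo : IsOpen (Metric.closedBall (0 : EuclideanSpace ℝ (Fin m)) 2)ᶜ :=
    Metric.isClosed_closedBall.isOpen_compl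
  obtain ⟨M₁, hM₁⟩ := (HasCompactSupport.intro (isCompact_closedBall _ _)
    fun y hy => lap_eq_zero_of_eqOn_const hKo hχ0 hy).exists_bound_of_continuous
      (continuous_lap hχ)
  obtain ⟨M₂, hM₂⟩ := (HasCompactSupport.intro (isCompact_closedBall _ _)
    fun y hy => hfd hKo hχ0 y hy).exists_bound_of_continuous hPc
  let η : ℝ → ℝ := fun s => Real.smoothTransition (2 * (s + 1))
  have hη : ContDiff ℝ 2 η := (Real.smoothTransition.contDiff (n := 2)).comp (by fun_prop)
  have hηd : Continuous (deriv η) := hη.continuous_deriv (by norm_num)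
  have hη1 : ∀ s, -(1 / 2) < s → η s = 1 := fun s hs =>
    Real.smoothTransition.one_of_one_le (by linarith)
  have hηd0 : ∀ s, -(1 / 2) < s → deriv η s = 0 := by
    intro s hs
    have : η =ᶠ[nhds s] fun _ => 1 := by
      filter_upwards [lt_mem_nhds hs] with z hz using hη1 z hz
    rw [this.deriv_eq, deriv_const]
  obtain ⟨M₃, hM₃⟩ := (isCompact_Icc (a := (-1 : ℝ)) (b := 0)).exists_bound_of_continuousOn
    hηd.continuousOn
  obtain ⟨B, hB, hGB⟩ := exists_gaussKernel_bound m
  have hM₁0 : 0 ≤ M₁ := (norm_nonneg _).trans (hM₁ 0)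
  have hM₂0 : 0 ≤ M₂ := (norm_nonneg _).trans (hM₂ 0)
  have hM₃0 : 0 ≤ M₃ := (norm_nonneg _).trans (hM₃ 0 (by simp))
  set H : ℝ := (1 / 2) ^ (-(m / 2 : ℝ))
  have hH0 : 0 < H := Real.rpow_pos_of_pos (by norm_num) _
  set C : ℝ := B * M₁ + M₂ * B + M₃ * H + 1
  have hC0 : 0 < C := by positivity
  have hD0 : 0 < (4 * Real.pi) ^ (m / 2 : ℝ) := Real.rpow_pos_of_pos (by positivity) _
  refine ⟨C / (4 * Real.pi) ^ (m / 2 : ℝ), by positivity, fun u hu hu0 hsub => ?_⟩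
  have main : ∀ ε : ℝ, 0 < ε → ε ≤ 1 → ∫ y, (u y 0 * χ y) * gaussKernel ε y ≤
      C * ∫ s in Set.Icc (-1 : ℝ) 0, ∫ y in Metric.closedBall 0 2, u y s := by
    intro ε hε hε1
    have hG := fun (y : EuclideanSpace ℝ (Fin m)) {s : ℝ} (hs : s ∈ Set.Icc (-1 : ℝ) 0) =>
      gaussKernel_nonneg (τ := ε - s) (by linarith [hs.2]) y
    have hη0 : ∀ s, 0 ≤ η s := fun s => Real.smoothTransition.nonneg _
    have hGc : ContinuousOn (fun p : EuclideanSpace ℝ (Fin m) × ℝ => gaussKernel (ε - p.2) p.1)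
        (Set.univ ×ˢ Set.Icc (-1 : ℝ) 0) :=
      continuousOn_gaussKernel.comp
        (f := fun p : EuclideanSpace ℝ (Fin m) × ℝ => (ε - p.2, p.1)) (by fun_prop)
        fun p hp => ⟨by have := hp.2.2; simp only [Set.mem_Ioi]; linarith, trivial⟩
    have hχc : ContinuousOn (fun p : EuclideanSpace ℝ (Fin m) × ℝ => χ p.1)
        (Set.univ ×ˢ Set.Icc (-1 : ℝ) 0) := (hχ.continuous.comp continuous_fst).continuousOn
    have hηc : ContinuousOn (fun p : EuclideanSpace ℝ (Fin m) × ℝ => η p.2)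
        (Set.univ ×ˢ Set.Icc (-1 : ℝ) 0) := (hη.continuous.comp continuous_snd).continuousOn
    have hηdc : ContinuousOn (fun p : EuclideanSpace ℝ (Fin m) × ℝ => deriv η p.2)
        (Set.univ ×ˢ Set.Icc (-1 : ℝ) 0) := (hηd.comp continuous_snd).continuousOn
    have h := integral_mul_le_of_subsolution hu hu0 hsub (C := C)
      (w := fun y s => η s * (χ y * gaussKernel (ε - s) y))
      (w' := fun y s => deriv η s * (χ y * gaussKernel (ε - s) y) +
        η s * (χ y * -((‖y‖ ^ 2 / (4 * (ε - s) ^ 2) - m / (2 * (ε - s))) *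
          gaussKernel (ε - s) y)))
      (fun s _ => contDiff_const.mul (hχ.mul (contDiff_gaussKernel _)))
      (fun s _ y hy => by simp [hχ0 y hy])
      (fun y s hs => mul_nonneg (hη0 s) (mul_nonneg χ.nonneg (hG y hs)))
      (fun y s hs => by
        have hτ : 0 < ε - s := by linarith [hs.2]
        have h1 : HasDerivAt η (deriv η s) s :=
          (hη.differentiable (by norm_num)).differentiableAt.hasDerivAt
        have h2 := (hasDerivAt_gaussKernel_time hτ y).scomp s ((hasDerivAt_id s).const_sub ε)
        refine (h1.mul (h2.const_mul (χ y))).congr_deriv ?_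
        simp)
      (hηc.mul (hχc.mul hGc))
      ((hηdc.mul (hχc.mul hGc)).add (hηc.mul (hχc.mul (ContinuousOn.neg (ContinuousOn.mul
        (ContinuousOn.sub
          (ContinuousOn.div (by fun_prop) (by fun_prop) fun p hp => by
            have : 0 < ε - p.2 := by linarith [hp.2.2]
            positivity)
          (ContinuousOn.div (by fun_prop) (by fun_prop) fun p hp => by
            have : 0 < ε - p.2 := by linarith [hp.2.2]
            positivity)) hGc)))))
      (fun y => by
        have : η (-1) = 0 := Real.smoothTransition.zero_of_nonpos (by norm_num)
        simp [this])
      (fun y s hs => by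
        have hτ : 0 < ε - s := by linarith [hs.2]
        have hGy := hG y hs
        have hGτ : 0 ≤ gaussKernel (ε - s) y / (ε - s) := div_nonneg hGy hτ.le
        rw [lap_const_mul, lap_mul_gaussKernel hχ hτ]
        change η s * (gaussKernel (ε - s) y * lap χ y - P y * (gaussKernel (ε - s) y / (ε - s)) + _)
          + _ ≤ _
        have hspace : gaussKernel (ε - s) y * lap χ y
            - P y * (gaussKernel (ε - s) y / (ε - s)) ≤ B * M₁ + M₂ * B := by
          rcases lt_or_ge ‖y‖ 1 with hy | hy
          · have hy' : y ∈ Metric.ball (0 : EuclideanSpace ℝ (Fin m)) 1 := by simpa using hy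
            rw [hfd Metric.isOpen_ball hχ1 y hy',
              lap_eq_zero_of_eqOn_const Metric.isOpen_ball hχ1 hy']
            simp only [mul_zero, zero_mul, sub_zero]
            positivity
          · obtain ⟨b1, b2⟩ := hGB (ε - s) hτ (by linarith [hs.1]) y hy
            have h1 : gaussKernel (ε - s) y * lap χ y ≤ B * M₁ :=
              (mul_le_mul_of_nonneg_left ((le_abs_self _).trans (hM₁ y)) hGy).trans
                (mul_le_mul_of_nonneg_right b1 hM₁0)
            have h2 : -P y * (gaussKernel (ε - s) y / (ε - s)) ≤ M₂ * B :=
              (mul_le_mul_of_nonneg_right ((neg_le_abs _).trans (hM₂ y)) hGτ).trans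
                (mul_le_mul_of_nonneg_left b2 hM₂0)
            linarith
        have htime : deriv η s * (χ y * gaussKernel (ε - s) y) ≤ M₃ * H := by
          rcases lt_or_ge (-(1 / 2)) s with h | h
          · rw [hηd0 s h, zero_mul]
            positivity
          · have h1 : χ y * gaussKernel (ε - s) y ≤ H :=
              (mul_le_of_le_one_left hGy χ.le_one).trans
                (gaussKernel_le_of_half_le (by linarith) y)
            exact (mul_le_mul_of_nonneg_right ((le_abs_self _).trans (hM₃ s hs))
              (mul_nonneg χ.nonneg hGy)).trans (mul_le_mul_of_nonneg_left h1 hM₃0)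
        have hspace' := mul_le_mul_of_nonneg_left hspace (hη0 s)
        have hle : η s * (B * M₁ + M₂ * B) ≤ B * M₁ + M₂ * B :=
          mul_le_of_le_one_left (by positivity) (Real.smoothTransition.le_one _)
        linarith)
    refine le_trans (le_of_eq ?_) h
    rw [setIntegral_eq_integral_of_forall_compl_eq_zero
      fun y hy => by rw [hχ0 y hy, zero_mul, mul_zero, mul_zero]]
    refine integral_congr_ae (Filter.Eventually.of_forall fun y => ?_)
    dsimp only
    rw [hη1 0 (by norm_num), sub_zero]
    ring
  have hg : Continuous fun y => u y 0 * χ y := (contDiff_slice hu 0).continuous.mul hχ.continuous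
  have hlim := tendsto_integral_gaussKernel hg
    (hg.integrable_of_hasCompactSupport χ.hasCompactSupport.mul_left)
  rw [hχ1 0 (by simp), mul_one] at hlim
  have := le_of_tendsto hlim (b := C * ∫ s in Set.Icc (-1 : ℝ) 0,
      ∫ y in Metric.closedBall 0 2, u y s) <| by
    filter_upwards [Filter.eventually_ge_atTop 1] with c hc
    refine main _ (by positivity) ?_
    rw [div_le_one (by positivity)]
    nlinarith
  rw [div_mul_eq_mul_div, le_div_iff₀ hD0]
  linarith

/-- Li–Tam parabolic mean value inequality on Euclidean space.
There is a dimensional constant `C = C(m) > 0` such that any smooth nonnegative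
`v` with `(Δ - ∂_t) v ≥ 0` on `ℝᵐ × [0, T]`, `T = R²/4`, satisfies
`sup_{B(0,R/2)×[R²/8,R²/4]} v ≤ (C / (R² |B(0,R)|)) ∫_{R²/16}^{R²/4} ∫_{B(0,R)} v`. -/
theorem stmt13 (m : ℕ) :
    ∃ C > (0 : ℝ), ∀ (v : EuclideanSpace ℝ (Fin m) → ℝ → ℝ) (R : ℝ), 0 < R →
      ContDiff ℝ (⊤ : ℕ∞) (fun p : EuclideanSpace ℝ (Fin m) × ℝ => v p.1 p.2) →
      (∀ x, ∀ t ∈ Set.Icc (0 : ℝ) (R ^ 2 / 4), 0 ≤ v x t) →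
      (∀ x, ∀ t ∈ Set.Icc (0 : ℝ) (R ^ 2 / 4),
        0 ≤ lap (fun y => v y t) x - deriv (v x) t) →
      ∀ x ∈ Metric.ball (0 : EuclideanSpace ℝ (Fin m)) (R / 2),
        ∀ t ∈ Set.Icc (R ^ 2 / 8) (R ^ 2 / 4),
        v x t ≤ C / (R ^ 2 *
            (volume (Metric.ball (0 : EuclideanSpace ℝ (Fin m)) R)).toReal) *
          ∫ s in Set.Icc (R ^ 2 / 16) (R ^ 2 / 4),
            ∫ y in Metric.ball (0 : EuclideanSpace ℝ (Fin m)) R, v y s := by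
  obtain ⟨C, hC, hmv⟩ := exists_mean_value_unit m
  set V : ℝ := (volume (Metric.ball (0 : EuclideanSpace ℝ (Fin m)) 1)).toReal
  have hV0 : 0 < V := ENNReal.toReal_pos (Metric.measure_ball_pos _ _ one_pos).ne'
    measure_ball_lt_top.ne
  refine ⟨C * 4 ^ (m + 2) * V, by positivity, fun v R hR hv hv0 hsub x hx t ht => ?_⟩
  set r : ℝ := R / 4 with hr
  have hr0 : 0 < r := by positivity
  have htime : ∀ s ∈ Set.Icc (-1 : ℝ) 0, t + r ^ 2 * s ∈ Set.Icc (0 : ℝ) (R ^ 2 / 4) := by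
    intro s hs
    have h1 := ht.1
    have h2 := ht.2
    have h3 : r ^ 2 = R ^ 2 / 16 := by rw [hr]; ring
    have h4 : 0 < r ^ 2 := by positivity
    constructor
    · nlinarith [hs.1]
    · nlinarith [hs.2]
  have h := hmv (fun y s => v (x + r • y) (t + r ^ 2 * s))
    (hv.comp (f := fun p : EuclideanSpace ℝ (Fin m) × ℝ => (x + r • p.1, t + r ^ 2 * p.2))
      (by fun_prop))
    (fun y s hs => hv0 _ _ (htime s hs))
    (fun y s hs => by
      have hd : deriv (fun s => v (x + r • y) (t + r ^ 2 * s)) s =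
          r ^ 2 * deriv (v (x + r • y)) (t + r ^ 2 * s) := by
        have := (hasDerivAt_time hv (x + r • y) (t + r ^ 2 * s)).scomp s
          (((hasDerivAt_id s).const_mul (r ^ 2)).const_add t)
        refine this.deriv.trans ?_
        simp
      rw [hd, lap_comp_add_smul (fun z => v z (t + r ^ 2 * s)), ← mul_sub]
      exact mul_nonneg (by positivity) (hsub _ _ (htime s hs)))
  simp only [smul_zero, add_zero, mul_zero] at h
  set K : Set (EuclideanSpace ℝ (Fin m)) := Metric.closedBall x (2 * r) with hK
  have hspace : ∀ s, ∫ y in Metric.closedBall 0 2, v (x + r • y) s =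
      (r ^ m)⁻¹ * ∫ z in K, v z s := by
    intro s
    have h1 := Measure.setIntegral_comp_smul_of_pos volume (fun z => v (x + z) s)
      (Metric.closedBall (0 : EuclideanSpace ℝ (Fin m)) 2) hr0
    rw [smul_closedBall' hr0.ne', smul_zero, Real.norm_of_nonneg hr0.le, finrank_euclideanSpace,
      Fintype.card_fin, smul_eq_mul] at h1
    rw [h1]
    congr 1
    have h2 := (measurePreserving_add_left volume x).setIntegral_preimage_emb
      (measurableEmbedding_addLeft x) (fun z => v z s) K
    rw [← h2, hK, preimage_add_closedBall, sub_self, mul_comm r 2]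
  simp_rw [hspace] at h
  have hsubst : ∫ s in Set.Icc (-1 : ℝ) 0, (r ^ m)⁻¹ * ∫ z in K, v z (t + r ^ 2 * s) =
      (r ^ m)⁻¹ * ((r ^ 2)⁻¹ * ∫ s in Set.Icc (t - r ^ 2) t, ∫ z in K, v z s) := by
    rw [integral_const_mul, integral_Icc_eq_integral_Ioc, integral_Icc_eq_integral_Ioc,
      ← intervalIntegral.integral_of_le (by norm_num),
      ← intervalIntegral.integral_of_le (by nlinarith),
      intervalIntegral.integral_comp_add_mul (fun s => ∫ z in K, v z s) (by positivity) t]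
    simp [sub_eq_add_neg]
  rw [hsubst] at h
  have hKR : K ⊆ Metric.ball 0 R := by
    intro z hz
    rw [Metric.mem_ball] at hx ⊢
    rw [hK, Metric.mem_closedBall] at hz
    have := dist_triangle z x 0
    linarith
  have hI : Set.Icc (t - r ^ 2) t ⊆ Set.Icc (R ^ 2 / 16) (R ^ 2 / 4) := by
    have h3 : r ^ 2 = R ^ 2 / 16 := by rw [hr]; ring
    exact Set.Icc_subset_Icc (by linarith [ht.1]) ht.2
  have hint : ∀ {S : Set (EuclideanSpace ℝ (Fin m))} {a b : ℝ}, S ⊆ Metric.closedBall 0 R →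
      IntegrableOn (fun s => ∫ z in S, v z s) (Set.Icc a b) := by
    intro S a b hS
    have h1 := integrable_prod_of_continuousOn (F := fun p => v p.1 p.2)
      (isCompact_closedBall (0 : EuclideanSpace ℝ (Fin m)) R) (isCompact_Icc (a := a) (b := b))
      hv.continuous.continuousOn
    exact (h1.mono_measure (Measure.prod_mono (Measure.restrict_mono_set _ hS)
      le_rfl)).integral_prod_right
  have hball : Metric.ball (0 : EuclideanSpace ℝ (Fin m)) R ⊆ Metric.closedBall 0 R :=
    Metric.ball_subset_closedBall
  have hpos : ∀ s ∈ Set.Icc (R ^ 2 / 16) (R ^ 2 / 4), ∀ z, 0 ≤ v z s := fun s hs z =>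
    hv0 z s ⟨le_trans (by positivity) hs.1, hs.2⟩
  have hmono : ∫ s in Set.Icc (t - r ^ 2) t, ∫ z in K, v z s ≤
      ∫ s in Set.Icc (R ^ 2 / 16) (R ^ 2 / 4), ∫ z in Metric.ball 0 R, v z s := by
    calc ∫ s in Set.Icc (t - r ^ 2) t, ∫ z in K, v z s
        ≤ ∫ s in Set.Icc (t - r ^ 2) t, ∫ z in Metric.ball 0 R, v z s := by
          refine setIntegral_mono_on (hint (hKR.trans hball)) (hint hball) measurableSet_Icc
            fun s hs => ?_
          refine setIntegral_mono_set ?_ ?_ hKR.eventuallyLE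
          · exact ((contDiff_slice hv s).continuous.continuousOn.integrableOn_compact
              (isCompact_closedBall _ _)).mono_set hball
          · exact Filter.Eventually.of_forall (hpos s (hI hs))
      _ ≤ _ := by
          refine setIntegral_mono_set (hint hball) ?_ hI.eventuallyLE
          filter_upwards [ae_restrict_mem measurableSet_Icc] with s hs
          exact integral_nonneg (hpos s hs)
  have hvol : (volume (Metric.ball (0 : EuclideanSpace ℝ (Fin m)) R)).toReal = R ^ m * V := by
    rw [Measure.addHaar_ball_of_pos volume 0 hR, ENNReal.toReal_mul,
      ENNReal.toReal_ofReal (by positivity), finrank_euclideanSpace, Fintype.card_fin]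
  calc v x t ≤ C * ((r ^ m)⁻¹ * ((r ^ 2)⁻¹ * ∫ s in Set.Icc (t - r ^ 2) t, ∫ z in K, v z s)) := h
    _ ≤ C * ((r ^ m)⁻¹ * ((r ^ 2)⁻¹ * ∫ s in Set.Icc (R ^ 2 / 16) (R ^ 2 / 4),
          ∫ z in Metric.ball 0 R, v z s)) := by gcongr
    _ = _ := by
        rw [hvol, hr, div_pow, div_pow]
        field_simp
        ring
end
end
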